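/- Let β be any one of the nine ★-patterns ★32, 3★2, 32★, ★31, 3★1, 31★, ★21, 2★1, 21★ (those whose two integer entries appear in decreasing order). Then there are exactly five equivalence classes under 123 ↔ β: {∅}, {1}, {12}, {123, 21}, and a fifth class consisting of all other permutations. Equivalently: ∅, 1, and 12 are each isolated; 123 ≡ 21 and no permutation outside {123, 21} is equivalent to either; and any two permutations not in {∅, 1, 12, 123, 21} are equivalent to one another. -/

import Mathlib

/-!
Pattern-replacement equivalences between permutations of different lengths
(arXiv:1309.4802). A ★-pattern is encoded as a `List (Option ℕ)`, where `none`
is the placeholder ★ and `some k` an integer entry.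
-/

/-- A ★-pattern / star-string entry: `none` is ★, `some k` an integer `k`. -/
abbrev SPat := List (Option ℕ)

/-- The integer entries of a star-string, in order. -/
def ints (ρ : SPat) : List ℕ := ρ.filterMap id

/-- Two lists of naturals are order-isomorphic. -/
def OrdIso (u v : List ℕ) : Prop :=
  u.length = v.length ∧
  ∀ i j, i < u.length → j < u.length → (u.getD i 0 < u.getD j 0 ↔ v.getD i 0 < v.getD j 0)

/-- A valid string of distinct positive integers and ★'s. -/
def StarStr (ρ : SPat) : Prop := (ints ρ).Nodup ∧ ∀ k ∈ ints ρ, 0 < k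

/-- `r` (entry by entry) forms a copy of the ★-pattern `δ`: ★'s in the same
positions, and the integer entries order-isomorphic. -/
def IsCopy (r δ : SPat) : Prop :=
  r.length = δ.length ∧
  (∀ i, (r.getD i none = none ↔ δ.getD i none = none)) ∧
  OrdIso (ints r) (ints δ)

/-- `Repl a b ρ₁ ρ₂` : `ρ₂` is obtained from `ρ₁` by replacing an occurrence of `a`
as a (not necessarily contiguous) substring of `ρ₁` by `b`, entry by entry at the
same positions. -/
inductive Repl : SPat → SPat → SPat → SPat → Prop
  | nil : Repl [] [] [] []
  | keep {a b ρ₁ ρ₂} (x : Option ℕ) : Repl a b ρ₁ ρ₂ → Repl a b (x :: ρ₁) (x :: ρ₂)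
  | repl {a b ρ₁ ρ₂} (x y : Option ℕ) :
      Repl a b ρ₁ ρ₂ → Repl (x :: a) (y :: b) (x :: ρ₁) (y :: ρ₂)

/-- `π` is a permutation of `1, …, n` (as a list). -/
def IsPermList (π : List ℕ) : Prop := π.Perm (List.range' 1 π.length)

/-- `σ` is a result of the replacement `α → β` applied to the permutation `π`:
(1) `ρ₁` is `π` renumbered (order-isomorphically) with ★'s inserted anywhere;
(2) a substring `a` of `ρ₁` forming a copy of `α` is replaced (in place) by a
string `b` that is a copy of `β`, whose integers meet `ρ₁` only inside `a`, and
which agrees with `a` on the integer entries common to `α` and `β`;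
(3) dropping ★'s and renumbering gives the permutation `σ`. -/
def IsResult (α β : SPat) (π σ : List ℕ) : Prop :=
  ∃ ρ₁ ρ₂ a b : SPat,
    StarStr ρ₁ ∧ OrdIso π (ints ρ₁) ∧
    IsCopy a α ∧
    StarStr b ∧ IsCopy b β ∧
    (∀ k ∈ ints b, k ∈ ints ρ₁ → k ∈ ints a) ∧
    (∀ i j x, α.getD i none = some x → β.getD j none = some x →
      a.getD i none = b.getD j none) ∧
    Repl a b ρ₁ ρ₂ ∧
    IsPermList σ ∧ OrdIso (ints ρ₂) σ

/-- Equivalence under the bidirectional replacement `α ↔ β`: a finite sequence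
of `α → β` and `β → α` replacements. -/
def PermEquiv (α β : SPat) (π σ : List ℕ) : Prop :=
  Relation.ReflTransGen (fun τ υ => IsResult α β τ υ ∨ IsResult β α τ υ) π σ

/-- `π` is isolated under `α ↔ β`: no other permutation is equivalent to it. -/
def Isolated (α β : SPat) (π : List ℕ) : Prop :=
  ∀ σ : List ℕ, IsPermList σ → PermEquiv α β π σ → σ = π

/-- The identity permutation `1 2 ⋯ n`. -/
def idPerm (n : ℕ) : List ℕ := List.range' 1 n

/-- The reverse identity permutation `n (n-1) ⋯ 1`. -/
def ridPerm (n : ℕ) : List ℕ := (List.range' 1 n).reverse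

def pat123 : SPat := [some 1, some 2, some 3]
def pat132 : SPat := [some 1, some 3, some 2]
def patS32 : SPat := [none, some 3, some 2]
def pat3S2 : SPat := [some 3, none, some 2]
def pat32S : SPat := [some 3, some 2, none]
def patS31 : SPat := [none, some 3, some 1]
def pat3S1 : SPat := [some 3, none, some 1]
def pat31S : SPat := [some 3, some 1, none]
def patS21 : SPat := [none, some 2, some 1]
def pat2S1 : SPat := [some 2, none, some 1]
def pat21S : SPat := [some 2, some 1, none]
def pat12S : SPat := [some 1, some 2, none]
def pat1S3 : SPat := [some 1, none, some 3]
def patS23 : SPat := [none, some 2, some 3]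
def patS12 : SPat := [none, some 1, some 2]
def pat23S : SPat := [some 2, some 3, none]
def pat13S : SPat := [some 1, some 3, none]
def pat1S2 : SPat := [some 1, none, some 2]


/-! ### Order isomorphism -/

theorem OrdIso.rfl' (u : List ℕ) : OrdIso u u := ⟨rfl, fun _ _ _ _ => Iff.rfl⟩

theorem OrdIso.symm' {u v : List ℕ} (h : OrdIso u v) : OrdIso v u :=
  ⟨h.1.symm, fun i j hi hj => (h.2 i j (h.1 ▸ hi) (h.1 ▸ hj)).symm⟩

theorem OrdIso.trans' {u v w : List ℕ} (h : OrdIso u v) (k : OrdIso v w) : OrdIso u w :=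
  ⟨h.1.trans k.1, fun i j hi hj =>
    (h.2 i j hi hj).trans (k.2 i j (h.1 ▸ hi) (h.1 ▸ hj))⟩

/-- `f` is strictly increasing on the entries of `u`. -/
def MonoL (f : ℕ → ℕ) (u : List ℕ) : Prop := ∀ x ∈ u, ∀ y ∈ u, x < y → f x < f y

theorem MonoL.lt_iff {f : ℕ → ℕ} {u : List ℕ} (h : MonoL f u) {x y : ℕ} (hx : x ∈ u)
    (hy : y ∈ u) : x < y ↔ f x < f y := by
  constructor
  · exact h x hx y hy
  · intro hl
    by_contra hc
    rcases Nat.lt_or_eq_of_le (Nat.le_of_not_lt hc) with h1 | h1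
    · have := h y hy x hx h1; omega
    · subst h1; omega

theorem MonoL.ordIso {f : ℕ → ℕ} {u : List ℕ} (h : MonoL f u) : OrdIso u (u.map f) := by
  refine ⟨by simp, fun i j hi hj => ?_⟩
  have e1 : (u.map f).getD i 0 = f (u[i]) := by simp [List.getD, hi]
  have e2 : (u.map f).getD j 0 = f (u[j]) := by simp [List.getD, hj]
  have e3 : u.getD i 0 = u[i] := by simp [List.getD, hi]
  have e4 : u.getD j 0 = u[j] := by simp [List.getD, hj]
  rw [e1, e2, e3, e4]
  exact h.lt_iff (List.getElem_mem hi) (List.getElem_mem hj)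

theorem OrdIso.exists_map {u v : List ℕ} (hn : u.Nodup) (h : OrdIso u v) :
    ∃ f, MonoL f u ∧ v = u.map f := by
  refine ⟨fun x => v.getD (u.idxOf x) 0, ?_, ?_⟩
  · intro x hx y hy hxy
    have hi := List.idxOf_lt_length_of_mem hx
    have hj := List.idxOf_lt_length_of_mem hy
    have := (h.2 _ _ hi hj)
    simp only [List.getD, List.getElem?_eq_getElem hi, List.getElem?_eq_getElem hj,
      List.getElem_idxOf, Option.getD_some] at this
    simpa [List.getD] using this.1 hxy
  · apply List.ext_getElem
    · simp [h.1]
    · intro i h1 h2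
      have hi : i < u.length := by simpa using h2
      simp [hn.idxOf_getElem i hi, h1]

theorem MonoL.nodup {f : ℕ → ℕ} {u : List ℕ} (h : MonoL f u) (hn : u.Nodup) :
    (u.map f).Nodup := by
  refine List.Nodup.map_on ?_ hn
  intro x hx y hy e
  by_contra hc
  rcases Nat.lt_or_gt_of_ne hc with h1 | h1
  · have := h x hx y hy h1; omega
  · have := h y hy x hx h1; omega

theorem OrdIso.nodup {u v : List ℕ} (hn : u.Nodup) (h : OrdIso u v) : v.Nodup := by
  obtain ⟨f, hf, rfl⟩ := h.exists_map hn
  exact hf.nodup hn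

theorem MonoL.mono {f : ℕ → ℕ} {u v : List ℕ} (h : MonoL f u) (hs : v ⊆ u) : MonoL f v :=
  fun x hx y hy => h x (hs hx) y (hs hy)

/-- Standardization. -/
def std (u : List ℕ) : List ℕ := u.map fun x => u.countP (fun y => decide (y ≤ x))

theorem std_mono (u : List ℕ) : MonoL (fun x => u.countP (fun y => decide (y ≤ x))) u := by
  intro x hx y hy hxy
  have h1 : u.countP (fun t => decide (t ≤ y)) =
      u.countP (fun t => decide (t ≤ x)) + u.countP (fun t => decide (x < t ∧ t ≤ y)) := by
    clear hx hy
    induction u with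
    | nil => simp
    | cons a u ih =>
      simp only [List.countP_cons, ih, decide_eq_true_eq]
      split_ifs <;> omega
  have h2 : 0 < u.countP (fun t => decide (x < t ∧ t ≤ y)) :=
    List.countP_pos_iff.2 ⟨y, hy, by simpa using hxy⟩
  show u.countP _ < u.countP _
  omega

theorem std_iso (u : List ℕ) : OrdIso u (std u) := (std_mono u).ordIso

theorem std_perm {u : List ℕ} (hn : u.Nodup) : IsPermList (std u) := by
  unfold IsPermList
  have hnd : (std u).Nodup := (std_mono u).nodup hn
  apply List.Subperm.perm_of_length_le
  · apply List.Nodup.subperm hnd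
    intro k hk
    obtain ⟨x, hx, rfl⟩ := List.mem_map.1 hk
    have h2 : 0 < u.countP (fun t => decide (t ≤ x)) :=
      List.countP_pos_iff.2 ⟨x, hx, by simp⟩
    have h3 : u.countP (fun t => decide (t ≤ x)) ≤ u.length := List.countP_le_length
    simp only [List.mem_range'_1, std, List.length_map]
    omega
  · simp

theorem std_congr {u v : List ℕ} (hn : u.Nodup) (h : OrdIso u v) : std u = std v := by
  obtain ⟨f, hf, rfl⟩ := h.exists_map hn
  unfold std
  rw [List.map_map]
  apply List.map_congr_left
  intro x hx
  simp only [Function.comp, List.countP_map]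
  apply List.countP_congr
  intro y hy
  have := hf.lt_iff hx hy
  simp only [Function.comp, decide_eq_true_eq]
  omega

theorem IsPermList.nodup' {u : List ℕ} (h : IsPermList u) : u.Nodup :=
  h.nodup_iff.2 (List.nodup_range')

theorem std_of_perm {u : List ℕ} (h : IsPermList u) : std u = u := by
  unfold std
  conv_rhs => rw [← List.map_id u]
  apply List.map_congr_left
  intro x hx
  rw [h.countP_eq]
  have hx' : x ∈ List.range' 1 u.length := h.subset hx
  rw [List.mem_range'_1] at hx'
  have key : ∀ n, (List.range' 1 n).countP (fun y => decide (y ≤ x)) = min n x := by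
    intro n
    induction n with
    | zero => simp
    | succ n ih =>
      rw [List.range'_1_concat, List.countP_append, ih]
      simp only [List.countP_cons, List.countP_nil, decide_eq_true_eq]
      split_ifs <;> omega
  rw [key]
  simp only [id]
  omega

theorem perm_eq_of_iso {u v : List ℕ} (hu : IsPermList u) (hv : IsPermList v)
    (h : OrdIso u v) : u = v := by
  rw [← std_of_perm hu, ← std_of_perm hv, std_congr hu.nodup' h]

/-! ### Forward moves -/

/-- Substitution of `x, y, z` for `1, 2, 3` in a pattern entry. -/
def sb (x y z : ℕ) : Option ℕ → Option ℕ
  | some 1 => some x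
  | some 2 => some y
  | some 3 => some z
  | _ => none

/-- The list of possible patterns. -/
def goodPats : List (Option ℕ × Option ℕ × Option ℕ) :=
  [(none, some 3, some 2), (some 3, none, some 2), (some 3, some 2, none),
   (none, some 3, some 1), (some 3, none, some 1), (some 3, some 1, none),
   (none, some 2, some 1), (some 2, none, some 1), (some 2, some 1, none)]

/-- Replacing the increasing triple `x, y, z`. -/
def outp (p : Option ℕ × Option ℕ × Option ℕ) (x y z : ℕ) (A B C D : List ℕ) : List ℕ :=
  A ++ ((sb x y z p.1).toList ++ (B ++ ((sb x y z p.2.1).toList ++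
    (C ++ ((sb x y z p.2.2).toList ++ D)))))

/-- `L'` comes from `L` by a forward move without renumbering. -/
def Fwd (p : Option ℕ × Option ℕ × Option ℕ) (L L' : List ℕ) : Prop :=
  L.Nodup ∧ ∃ x y z A B C D, x < y ∧ y < z ∧
    L = A ++ x :: (B ++ y :: (C ++ z :: D)) ∧ L' = outp p x y z A B C D

theorem sb_map (f : ℕ → ℕ) (x y z : ℕ) (o : Option ℕ) :
    (sb x y z o).toList.map f = (sb (f x) (f y) (f z) o).toList := by
  unfold sb
  split <;> simp

theorem Fwd.map {p L L'} (h : Fwd p L L') {f : ℕ → ℕ} (hf : MonoL f L) :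
    Fwd p (L.map f) (L'.map f) := by
  obtain ⟨hn, x, y, z, A, B, C, D, h1, h2, rfl, rfl⟩ := h
  refine ⟨hf.nodup hn, f x, f y, f z, A.map f, B.map f, C.map f, D.map f,
    hf _ (by simp) _ (by simp) h1, hf _ (by simp) _ (by simp) h2, by simp, ?_⟩
  simp only [outp, List.map_append, sb_map]

theorem Fwd.append {p L L'} (h : Fwd p L L') {w : List ℕ} (hw : (L ++ w).Nodup) :
    Fwd p (L ++ w) (L' ++ w) := by
  obtain ⟨hn, x, y, z, A, B, C, D, h1, h2, rfl, rfl⟩ := h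
  exact ⟨hw, x, y, z, A, B, C, D ++ w, h1, h2, by simp, by simp [outp]⟩

theorem outp_perm {p} (hp : p ∈ goodPats) (x y z : ℕ) (A B C D : List ℕ) :
    ∃ m m1 m2, (outp p x y z A B C D).Perm (m1 :: m2 :: (A ++ (B ++ (C ++ D)))) ∧
      [x, y, z].Perm [m, m1, m2] := by
  simp only [goodPats, List.mem_cons, List.not_mem_nil, or_false] at hp
  rcases hp with rfl | rfl | rfl | rfl | rfl | rfl | rfl | rfl | rfl
  on_goal 1 => refine ⟨x, z, y, ?_⟩
  on_goal 2 => refine ⟨x, z, y, ?_⟩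
  on_goal 3 => refine ⟨x, z, y, ?_⟩
  on_goal 4 => refine ⟨y, z, x, ?_⟩
  on_goal 5 => refine ⟨y, z, x, ?_⟩
  on_goal 6 => refine ⟨y, z, x, ?_⟩
  on_goal 7 => refine ⟨z, y, x, ?_⟩
  on_goal 8 => refine ⟨z, y, x, ?_⟩
  on_goal 9 => refine ⟨z, y, x, ?_⟩
  all_goals
    constructor <;> rw [List.perm_iff_count] <;> intro t <;>
      simp only [outp, sb, List.count_append, List.count_cons, Option.toList, List.count_nil] <;>
      omega

theorem Fwd.facts {p} {L L' : List ℕ} (hp : p ∈ goodPats) (h : Fwd p L L') :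
    L' ⊆ L ∧ L'.Nodup ∧ ∃ m, m ∈ L ∧ m ∉ L' ∧ ∀ t ∈ L, t ≠ m → t ∈ L' := by
  obtain ⟨hn, x, y, z, A, B, C, D, h1, h2, rfl, rfl⟩ := h
  obtain ⟨m, m1, m2, hm, hm'⟩ := outp_perm hp x y z A B C D
  have hL : (A ++ x :: (B ++ y :: (C ++ z :: D))).Perm (m :: outp p x y z A B C D) := by
    refine List.Perm.trans ?_ (List.Perm.cons m hm).symm
    refine List.Perm.trans ?_ (List.Perm.append_right (A ++ (B ++ (C ++ D))) hm')
    rw [List.perm_iff_count]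
    intro t
    simp only [List.count_append, List.count_cons, List.count_nil]
    omega
  have hn' := hL.nodup_iff.1 hn
  rw [List.nodup_cons] at hn'
  refine ⟨fun t ht => hL.mem_iff.2 (by simp [ht]), hn'.2, m, hL.mem_iff.2 (by simp), hn'.1, ?_⟩
  intro t ht htm
  have := hL.mem_iff.1 ht
  simp only [List.mem_cons] at this
  tauto

/-! ### Moves give results -/

/-- The pattern list. -/
def toPat (p : Option ℕ × Option ℕ × Option ℕ) : SPat := [p.1, p.2.1, p.2.2]

theorem ints_append (u v : SPat) : ints (u ++ v) = ints u ++ ints v := by simp [ints]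

theorem ints_map_some (u : List ℕ) : ints (u.map some) = u := by simp [ints]

theorem ints_cons (o : Option ℕ) (u : SPat) : ints (o :: u) = o.toList ++ ints u := by
  cases o <;> simp [ints]

theorem Repl.keeps {a b ρ₁ ρ₂ : SPat} (w : SPat) (h : Repl a b ρ₁ ρ₂) :
    Repl a b (w ++ ρ₁) (w ++ ρ₂) := by
  induction w with
  | nil => exact h
  | cons o w ih => exact Repl.keep o ih

theorem Repl.sub1 {a b ρ₁ ρ₂ : SPat} (h : Repl a b ρ₁ ρ₂) : a.Sublist ρ₁ := by
  induction h with
  | nil => exact List.Sublist.slnil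
  | keep x _ ih => exact ih.cons x
  | repl x y _ ih => exact ih.cons_cons x

theorem Repl.sub2 {a b ρ₁ ρ₂ : SPat} (h : Repl a b ρ₁ ρ₂) : b.Sublist ρ₂ := by
  induction h with
  | nil => exact List.Sublist.slnil
  | keep x _ ih => exact ih.cons x
  | repl x y _ ih => exact ih.cons_cons y

theorem sb_mem (x y z : ℕ) (o : Option ℕ) {k : ℕ} (hk : k ∈ (sb x y z o).toList) :
    k ∈ [x, y, z] := by
  unfold sb at hk
  split at hk <;> simp at hk <;> simp [hk]

theorem repl3 (a1 a2 a3 b1 b2 b3 : Option ℕ) (A B C D : SPat) :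
    Repl [a1, a2, a3] [b1, b2, b3] (A ++ a1 :: (B ++ a2 :: (C ++ a3 :: D)))
      (A ++ b1 :: (B ++ b2 :: (C ++ b3 :: D))) := by
  refine Repl.keeps A (Repl.repl _ _ (Repl.keeps B (Repl.repl _ _ (Repl.keeps C
    (Repl.repl _ _ ?_)))))
  have := Repl.keeps D Repl.nil
  simpa using this

theorem ordIso3 {x y z : ℕ} (h1 : x < y) (h2 : y < z) : OrdIso [x, y, z] [1, 2, 3] := by
  have : MonoL (fun t => if t = x then 1 else if t = y then 2 else 3) [x, y, z] := by
    intro s hs t ht hst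
    simp only [List.mem_cons, List.not_mem_nil, or_false] at hs ht
    grind
  have h := this.ordIso
  have e1 : y ≠ x := by omega
  have e2 : z ≠ x := by omega
  have e3 : z ≠ y := by omega
  simpa [e1, e2, e3] using h

theorem ordIso2 {x y s t : ℕ} (h1 : y < x) (h2 : t < s) : OrdIso [x, y] [s, t] := by
  refine ⟨rfl, fun i j hi hj => ?_⟩
  simp only [List.length_cons, List.length_nil] at hi hj
  interval_cases i <;> interval_cases j <;> simp <;> omega

theorem copyA {x y z : ℕ} (h1 : x < y) (h2 : y < z) :
    IsCopy [some x, some y, some z] pat123 := by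
  refine ⟨rfl, fun i => ?_, ordIso3 h1 h2⟩
  match i with
  | 0 => simp [pat123]
  | 1 => simp [pat123]
  | 2 => simp [pat123]
  | n + 3 => simp [pat123]

theorem copyB {p} (hp : p ∈ goodPats) {x y z : ℕ} (h1 : x < y) (h2 : y < z) :
    IsCopy [sb x y z p.1, sb x y z p.2.1, sb x y z p.2.2] (toPat p) := by
  refine ⟨rfl, fun i => ?_, ?_⟩
  · simp only [goodPats, List.mem_cons, List.not_mem_nil, or_false] at hp
    rcases hp with rfl | rfl | rfl | rfl | rfl | rfl | rfl | rfl | rfl <;>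
    exact match i with
      | 0 => by simp [toPat, sb]
      | 1 => by simp [toPat, sb]
      | 2 => by simp [toPat, sb]
      | n + 3 => by simp [toPat, sb]
  · simp only [goodPats, List.mem_cons, List.not_mem_nil, or_false] at hp
    rcases hp with rfl | rfl | rfl | rfl | rfl | rfl | rfl | rfl | rfl <;>
    exact ordIso2 (by omega) (by omega)

theorem common (p) (x y z : ℕ) (i j k : ℕ)
    (hi : pat123.getD i none = some k) (hj : (toPat p).getD j none = some k) :
    ([some x, some y, some z] : SPat).getD i none =
      ([sb x y z p.1, sb x y z p.2.1, sb x y z p.2.2] : SPat).getD j none := by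
  have hb : ([sb x y z p.1, sb x y z p.2.1, sb x y z p.2.2] : SPat).getD j none
      = sb x y z ((toPat p).getD j none) := by
    exact match j with
      | 0 => rfl
      | 1 => rfl
      | 2 => rfl
      | n + 3 => by simp [toPat, sb]
  rw [hb, hj]
  revert hi
  exact match i with
      | 0 => by intro hi; simp [pat123] at hi; subst hi; rfl
      | 1 => by intro hi; simp [pat123] at hi; subst hi; rfl
      | 2 => by intro hi; simp [pat123] at hi; subst hi; rfl
      | n + 3 => by intro hi; simp [pat123] at hi

theorem Fwd.result {p} (hp : p ∈ goodPats) {L L' π σ : List ℕ} (h : Fwd p L L')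
    (hπ : IsPermList π) (hσ : IsPermList σ) (h1 : OrdIso π L) (h2 : OrdIso σ L') :
    IsResult pat123 (toPat p) π σ ∧ IsResult (toPat p) pat123 σ π := by
  wlog hpos : ∀ k ∈ L, 0 < k generalizing L L'
  · have hm : MonoL (fun t => t + 1) L := fun x _ y _ hxy => by simpa using hxy
    have hm' : MonoL (fun t => t + 1) L' := fun x _ y _ hxy => by simpa using hxy
    exact this (h.map hm) (h1.trans' hm.ordIso) (h2.trans' hm'.ordIso) (by simp)
  obtain ⟨hsub, hnd', m, -⟩ := h.facts hp
  have hpos' : ∀ k ∈ L', 0 < k := fun k hk => hpos k (hsub hk)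
  obtain ⟨hn, x, y, z, A, B, C, D, hxy, hyz, hL, hL'⟩ := h
  set a : SPat := [some x, some y, some z] with ha
  set b : SPat := [sb x y z p.1, sb x y z p.2.1, sb x y z p.2.2] with hb
  set ρ₁ : SPat := A.map some ++ some x :: (B.map some ++ some y :: (C.map some ++ some z ::
    D.map some)) with hρ₁
  set ρ₂ : SPat := A.map some ++ sb x y z p.1 :: (B.map some ++ sb x y z p.2.1 ::
    (C.map some ++ sb x y z p.2.2 :: D.map some)) with hρ₂
  have e1 : ints ρ₁ = L := by
    simp [hρ₁, ints_append, ints_cons, ints_map_some, hL]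
  have e2 : ints ρ₂ = L' := by
    simp [hρ₂, ints_append, ints_cons, ints_map_some, hL', outp]
  have ea : ints a = [x, y, z] := rfl
  have hR : Repl a b ρ₁ ρ₂ := repl3 _ _ _ _ _ _ _ _ _ _
  have haL : [x, y, z].Sublist L := by
    rw [← ea, ← e1]; exact hR.sub1.filterMap id
  have hbL : (ints b).Sublist L' := by
    rw [← e2]; exact hR.sub2.filterMap id
  have hb3 : ints b = (sb x y z p.1).toList ++ ((sb x y z p.2.1).toList ++
      (sb x y z p.2.2).toList) := by
    rw [hb, ints_cons, ints_cons, ints_cons]; simp [ints]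
  have hba : ints b ⊆ ints a := by
    rw [hb3, ea]
    intro k hk
    simp only [List.mem_append] at hk
    rcases hk with hk | hk | hk <;> exact sb_mem _ _ _ _ hk
  have sa : StarStr a := ⟨by rw [ea]; exact haL.nodup hn, by
    rw [ea]; exact fun k hk => hpos k (haL.subset hk)⟩
  have sbb : StarStr b := ⟨hbL.nodup hnd', fun k hk => hpos' k (hbL.subset hk)⟩
  refine ⟨⟨ρ₁, ρ₂, a, b, ?_, ?_, copyA hxy hyz, sbb, copyB hp hxy hyz, ?_, ?_, ?_, hσ, ?_⟩,
    ⟨ρ₂, ρ₁, b, a, ?_, ?_, copyB hp hxy hyz, sa, copyA hxy hyz, ?_, ?_, ?_, hπ, ?_⟩⟩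
  · exact ⟨e1 ▸ hn, e1 ▸ hpos⟩
  · rw [e1]; exact h1
  · exact fun k hk _ => hba hk
  · exact fun i j k hi hj => common p x y z i j k hi hj
  · exact hR
  · rw [e2]; exact h2.symm'
  · exact ⟨e2 ▸ hnd', e2 ▸ hpos'⟩
  · rw [e2]; exact h2
  · intro k hk hk2
    rw [e2, hL'] at hk2
    rw [ea] at hk
    rw [hL] at hn
    have hk3 : k ∉ A ∧ k ∉ B ∧ k ∉ C ∧ k ∉ D := by
      have hn2 := List.nodup_iff_count_le_one.1 hn k
      simp only [List.count_append, List.count_cons, beq_iff_eq] at hn2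
      simp only [List.mem_cons, List.not_mem_nil, or_false] at hk
      have hge : 1 ≤ (if x = k then 1 else 0) + (if y = k then 1 else 0) +
          (if z = k then 1 else 0) := by
        rcases hk with rfl | rfl | rfl <;> simp <;> omega
      refine ⟨?_, ?_, ?_, ?_⟩ <;> rw [← List.count_eq_zero] <;> omega
    rw [hb3]
    simp only [outp, List.mem_append] at hk2 ⊢
    tauto
  · exact fun i j k hi hj => (common p x y z j i k hj hi).symm
  · exact repl3 _ _ _ _ _ _ _ _ _ _
  · rw [e1]; exact h1.symm'

/-! ### The equivalence on lists of distinct naturals -/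

/-- Equivalence of lists of distinct naturals, up to order isomorphism. -/
inductive LEq (p : Option ℕ × Option ℕ × Option ℕ) : List ℕ → List ℕ → Prop
  | iso {u v} : u.Nodup → OrdIso u v → LEq p u v
  | fwd {u v} : Fwd p u v → LEq p u v
  | bwd {u v} : Fwd p v u → LEq p u v
  | trans {u v w} : LEq p u v → LEq p v w → LEq p u w

theorem LEq.nodup {p} (hp : p ∈ goodPats) {u v : List ℕ} (h : LEq p u v) :
    u.Nodup ∧ v.Nodup := by
  induction h with
  | iso h1 h2 => exact ⟨h1, h2.nodup h1⟩
  | fwd h => exact ⟨h.1, (h.facts hp).2.1⟩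
  | bwd h => exact ⟨(h.facts hp).2.1, h.1⟩
  | trans _ _ ih1 ih2 => exact ⟨ih1.1, ih2.2⟩

theorem LEq.symm {p} {u v : List ℕ} (h : LEq p u v) : LEq p v u := by
  induction h with
  | iso h1 h2 => exact LEq.iso (h2.nodup h1) h2.symm'
  | fwd h => exact LEq.bwd h
  | bwd h => exact LEq.fwd h
  | trans _ _ ih1 ih2 => exact LEq.trans ih2 ih1

theorem LEq.sound {p} (hp : p ∈ goodPats) {u v : List ℕ} (h : LEq p u v) :
    ∀ π σ, IsPermList π → IsPermList σ → OrdIso π u → OrdIso σ v →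
      PermEquiv pat123 (toPat p) π σ := by
  induction h with
  | iso h1 h2 =>
    intro π σ hπ hσ hu hv
    have : π = σ := perm_eq_of_iso hπ hσ ((hu.trans' h2).trans' hv.symm')
    subst this
    exact Relation.ReflTransGen.refl
  | fwd h =>
    intro π σ hπ hσ hu hv
    exact Relation.ReflTransGen.single (Or.inl (h.result hp hπ hσ hu hv).1)
  | bwd h =>
    intro π σ hπ hσ hu hv
    exact Relation.ReflTransGen.single (Or.inr (h.result hp hσ hπ hv hu).2)
  | @trans u v w h1 _ ih1 ih2 =>
    intro π σ hπ hσ hu hv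
    have hn := (h1.nodup hp).2
    exact Relation.ReflTransGen.trans
      (ih1 π (std v) hπ (std_perm hn) hu (std_iso v).symm')
      (ih2 (std v) σ (std_perm hn) hσ (std_iso v).symm' hv)

theorem LEq.lift {p} (hp : p ∈ goodPats) {u v : List ℕ} (h : LEq p u v) :
    ∀ u0 w, OrdIso u u0 → (u0 ++ w).Nodup →
      ∃ v0 w', OrdIso v v0 ∧ (v0 ++ w').Nodup ∧ w'.length = w.length ∧
        LEq p (u0 ++ w) (v0 ++ w') := by
  induction h with
  | iso h1 h2 =>
    intro u0 w hu hn
    exact ⟨u0, w, h2.symm'.trans' hu, hn, rfl, LEq.iso hn (OrdIso.rfl' _)⟩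
  | fwd h =>
    intro u0 w hu hn
    obtain ⟨f, hf, rfl⟩ := hu.exists_map h.1
    have h2 := (h.map hf).append hn
    exact ⟨_, w, (hf.mono (h.facts hp).1).ordIso, (h2.facts hp).2.1, rfl, LEq.fwd h2⟩
  | @bwd u v h =>
    intro u0 w hu hn
    obtain ⟨hsub, hnu, m, hmv, hmu, hm⟩ := h.facts hp
    obtain ⟨f, hf, rfl⟩ := hu.exists_map hnu
    set K : ℕ := ((u.filter (fun t => decide (t < m))).toFinset).sup (fun t => f t + 1) with hK
    have hK1 : ∀ t ∈ u, t < m → f t + 1 ≤ K := by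
      intro t ht htm
      exact Finset.le_sup (f := fun t => f t + 1) (by simp [ht, htm])
    have hK2 : ∀ t ∈ u, m < t → K ≤ f t := by
      intro t ht htm
      apply Finset.sup_le
      intro s hs
      simp only [List.mem_toFinset, List.mem_filter, decide_eq_true_eq] at hs
      exact hf s hs.1 t ht (by omega)
    set g : ℕ → ℕ := fun t => if t = m then 2 * K else 2 * f t + 1 with hg
    have hgm : g m = 2 * K := by simp [hg]
    have hgt : ∀ t, t ≠ m → g t = 2 * f t + 1 := fun t ht => by simp [hg, ht]
    have hgv : MonoL g v := by
      intro s hs t ht hst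
      by_cases e1 : s = m
      · have e2 : t ≠ m := by omega
        have := hK2 t (hm t ht e2) (by omega)
        rw [e1, hgm, hgt t e2]; omega
      · by_cases e2 : t = m
        · have := hK1 s (hm s hs e1) (by omega)
          rw [e2, hgm, hgt s e1]; omega
        · have := hf s (hm s hs e1) t (hm t ht e2) hst
          rw [hgt s e1, hgt t e2]; omega
    have hd : ∀ L : List ℕ, MonoL (fun t => 2 * t + 1) L := by
      intro L s _ t _ hst
      show 2 * s + 1 < 2 * t + 1
      omega
    have hug : u.map g = (u.map f).map (fun t => 2 * t + 1) := by
      rw [List.map_map]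
      apply List.map_congr_left
      intro t ht
      exact hgt t (fun e => hmu (e ▸ ht))
    have hiso : OrdIso (u.map f ++ w) (u.map g ++ w.map (fun t => 2 * t + 1)) := by
      rw [hug, ← List.map_append]
      exact (hd _).ordIso
    have hn2 := hiso.nodup hn
    have hn3 : (v.map g ++ w.map (fun t => 2 * t + 1)).Nodup := by
      rw [List.nodup_append'] at hn2 ⊢
      refine ⟨hgv.nodup h.1, hn2.2.1, ?_⟩
      intro k hk hkw
      obtain ⟨t, ht, rfl⟩ := List.mem_map.1 hk
      by_cases e : t = m
      · obtain ⟨s, hs, hs'⟩ := List.mem_map.1 hkw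
        rw [e, hgm] at hs'
        omega
      · exact hn2.2.2 (List.mem_map.2 ⟨t, hm t ht e, rfl⟩) hkw
    exact ⟨v.map g, w.map (fun t => 2 * t + 1), hgv.ordIso, hn3, by simp,
      LEq.trans (LEq.iso hn hiso) (LEq.bwd ((h.map hgv).append hn3))⟩
  | trans _ _ ih1 ih2 =>
    intro u0 w hu hn
    obtain ⟨v0, w1, a1, a2, a3, a4⟩ := ih1 u0 w hu hn
    obtain ⟨v1, w2, b1, b2, b3, b4⟩ := ih2 v0 w1 a1 a2
    exact ⟨v1, w2, b1, b2, b3.trans a3, a4.trans b4⟩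

/-! ### Checking explicit chains -/

/-- All ways of splitting a list at an entry. -/
def picks : List ℕ → List (List ℕ × ℕ × List ℕ)
  | [] => []
  | a :: l => ([], a, l) :: (picks l).map fun t => (a :: t.1, t.2.1, t.2.2)

theorem picks_spec {l : List ℕ} {t : List ℕ × ℕ × List ℕ} (h : t ∈ picks l) :
    l = t.1 ++ t.2.1 :: t.2.2 := by
  induction l generalizing t with
  | nil => simp [picks] at h
  | cons a l ih =>
    simp only [picks, List.mem_cons, List.mem_map] at h
    rcases h with rfl | ⟨s, hs, rfl⟩
    · rfl
    · simp [ih hs]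

/-- All results of forward moves. -/
def fwds (p : Option ℕ × Option ℕ × Option ℕ) (L : List ℕ) : List (List ℕ) :=
  (picks L).flatMap fun s => (picks s.2.2).flatMap fun t => (picks t.2.2).flatMap fun r =>
    if s.2.1 < t.2.1 ∧ t.2.1 < r.2.1 then
      [outp p s.2.1 t.2.1 r.2.1 s.1 t.1 r.1 r.2.2] else []

theorem fwds_spec {p} {L L' : List ℕ} (hn : L.Nodup) (h : L' ∈ fwds p L) : Fwd p L L' := by
  simp only [fwds, List.mem_flatMap] at h
  obtain ⟨s, hs, t, ht, r, hr, h⟩ := h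
  split_ifs at h with hc
  · simp only [List.mem_singleton] at h
    refine ⟨hn, s.2.1, t.2.1, r.2.1, s.1, t.1, r.1, r.2.2, hc.1, hc.2, ?_, h⟩
    rw [← picks_spec hr, ← picks_spec ht, ← picks_spec hs]
  · simp at h

/-- One checked step. -/
def stepOK (p : Option ℕ × Option ℕ × Option ℕ) (a b : List ℕ) : Bool :=
  decide a.Nodup && decide b.Nodup &&
    ((fwds p a).any (fun c => std c == b) || (fwds p b).any (fun c => std c == a))

theorem fwd_std {p} (hp : p ∈ goodPats) {a b : List ℕ} (hn : a.Nodup)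
    (h : (fwds p a).any (fun c => std c == b) = true) : LEq p a b := by
  simp only [List.any_eq_true, beq_iff_eq] at h
  obtain ⟨c, hc, rfl⟩ := h
  have hF := fwds_spec hn hc
  exact (LEq.fwd hF).trans (LEq.iso (hF.facts hp).2.1 (std_iso c))

theorem stepOK_spec {p} (hp : p ∈ goodPats) {a b : List ℕ} (h : stepOK p a b = true) :
    LEq p a b := by
  simp only [stepOK, Bool.and_eq_true, Bool.or_eq_true, decide_eq_true_eq] at h
  rcases h.2 with h2 | h2
  · exact fwd_std hp h.1.1 h2
  · exact (fwd_std hp h.1.2 h2).symm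

/-- The last perm of a chain starting with `a`. -/
def lastOf (a : List ℕ) : List (List ℕ) → List ℕ
  | [] => a
  | b :: l => lastOf b l

/-- A checked chain. -/
def chainOK (p : Option ℕ × Option ℕ × Option ℕ) (a : List ℕ) : List (List ℕ) → Bool
  | [] => decide a.Nodup
  | b :: l => stepOK p a b && chainOK p b l

theorem chainOK_spec {p} (hp : p ∈ goodPats) {a : List ℕ} {l : List (List ℕ)}
    (h : chainOK p a l = true) : LEq p a (lastOf a l) := by
  induction l generalizing a with
  | nil => exact LEq.iso (by simpa [chainOK] using h) (OrdIso.rfl' _)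
  | cons b l ih =>
    simp only [chainOK, Bool.and_eq_true] at h
    exact (stepOK_spec hp h.1).trans (ih h.2)

/-- Decimal digits. -/
def dec : ℕ → ℕ → List ℕ
  | 0, _ => []
  | k + 1, n => if n = 0 then [] else dec k (n / 10) ++ [n % 10]

/-- The whole certificate check: for every permutation of length 4 there is a chain to
a permutation of length 3, and for each one of length 3 but `123` a chain to `321`. -/
def checkAll (p : Option ℕ × Option ℕ × Option ℕ) (cs : List (List ℕ)) : Bool :=
  ((List.range' 1 4).permutations'.all fun P => cs.any fun c =>
    chainOK p P (c.map (dec 7)) && (lastOf P (c.map (dec 7))).length == 3) &&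
  ((List.range' 1 3).permutations'.all fun P => P == [1, 2, 3] || cs.any fun c =>
    chainOK p P (c.map (dec 7)) && lastOf P (c.map (dec 7)) == [3, 2, 1])

/-- Chains for pattern 0, without their first entries. -/
def cert0 : List (List ℕ) :=
  [[], [132], [231], [312], [321], [1234, 321], [2314, 12435, 1423, 321],
   [3124, 12435, 1423, 321], [12345, 1324, 231], [12354, 1423, 321], [12435, 1423, 321],
   [12453, 2341, 321], [12534, 4123, 321], [12543, 2431, 13245, 2314, 312], [13245, 2314, 312]]

/-- Chains for pattern 1, without their first entries. -/
def cert1 : List (List ℕ) :=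
  [[], [132], [231], [312], [321], [1234, 321], [1243, 312, 1234, 321], [12345, 1423, 231],
   [12354, 1423, 231], [12435, 1423, 231], [12453, 2341, 321], [12534, 1342, 321],
   [12543, 2431, 31245, 2314, 312], [31245, 2314, 312]]

/-- Chains for pattern 2, without their first entries. -/
def cert2 : List (List ℕ) :=
  [[], [132], [213], [231], [321], [1243, 12345, 1324, 321], [1423, 12345, 1324, 321],
   [2134, 12345, 1324, 321], [12354, 1423, 231], [12435, 2134, 132], [12453, 2134, 132],
   [13245, 1423, 231], [13425, 1432, 12435, 2134, 132], [13452, 1432, 12435, 2134, 132],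
   [14235, 2314, 321], [14325, 124356, 12354, 1423, 231], [15234, 2413, 23145, 1243, 213],
   [15324, 124356, 12354, 1423, 231], [15423, 125346, 12453, 2134, 132], [23145, 1243, 213]]

/-- Chains for pattern 3, without their first entries. -/
def cert3 : List (List ℕ) :=
  [[], [231], [312], [321], [1234, 321], [1243, 231, 1234, 321], [12345, 2341, 321],
   [12354, 2341, 321], [12435, 2341, 321], [12453, 2341, 321], [12534, 4123, 321],
   [12543, 2431, 12345, 2341, 321], [23145, 2341, 321]]

/-- Chains for pattern 4, without their first entries. -/
def cert4 : List (List ℕ) :=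
  [[], [231], [312], [321], [1234, 321], [1243, 12345, 1324, 321], [12345, 1324, 321],
   [12354, 1423, 231], [12435, 2314, 312], [12453, 2341, 321], [12534, 1342, 312],
   [12543, 2431, 21345, 2314, 312], [21345, 2314, 312]]

/-- Chains for pattern 5, without their first entries. -/
def cert5 : List (List ℕ) :=
  [[], [213], [231], [312], [321], [1234, 321], [1423, 12345, 1324, 321], [12345, 1423, 231],
   [12354, 1423, 231], [12435, 1423, 231], [12453, 1423, 231], [12534, 1342, 312],
   [13245, 1423, 231], [13425, 3124, 231], [15234, 2413, 21345, 2314, 321], [21345, 2314, 321],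
   [31245, 2314, 321]]

/-- Chains for pattern 6, without their first entries. -/
def cert6 : List (List ℕ) :=
  [[], [231], [312], [321], [1243, 12345, 2341, 321], [1342, 12345, 2341, 321],
   [2134, 12345, 2341, 321], [12354, 2341, 321], [12435, 2134, 231], [12453, 2341, 321],
   [13245, 1243, 231], [13425, 1423, 321], [13452, 1432, 12435, 2134, 231],
   [14235, 1432, 12435, 2134, 231], [14253, 3241, 13245, 1243, 231],
   [14325, 124356, 23145, 2341, 321], [14352, 124356, 23145, 2341, 321],
   [14532, 124536, 12534, 2134, 231], [23145, 2341, 321]]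

/-- Chains for pattern 7, without their first entries. -/
def cert7 : List (List ℕ) :=
  [[], [231], [312], [321], [1234, 321], [1342, 12345, 2341, 321], [12345, 2341, 321],
   [12354, 2341, 321], [12435, 1342, 312], [12453, 2341, 321], [13245, 2341, 321],
   [13425, 2341, 321], [13452, 1432, 12345, 2341, 321], [21345, 2341, 321], [23145, 2341, 321]]

/-- Chains for pattern 8, without their first entries. -/
def cert8 : List (List ℕ) :=
  [[], [213], [231], [312], [321], [1234, 321], [1342, 13245, 2314, 321],
   [1423, 13245, 2314, 321], [12345, 1324, 231], [12354, 1324, 231], [12435, 1423, 231],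
   [13245, 1423, 231], [13425, 2341, 321], [14235, 2314, 321], [14325, 2431, 21345, 2314, 321],
   [21345, 2314, 321]]

theorem cert_exists {p} (hp : p ∈ goodPats) : ∃ cs, checkAll p cs = true := by
  simp only [goodPats, List.mem_cons, List.not_mem_nil, or_false] at hp
  rcases hp with rfl | rfl | rfl | rfl | rfl | rfl | rfl | rfl | rfl
  · exact ⟨cert0, by decide +kernel⟩
  · exact ⟨cert1, by decide +kernel⟩
  · exact ⟨cert2, by decide +kernel⟩
  · exact ⟨cert3, by decide +kernel⟩
  · exact ⟨cert4, by decide +kernel⟩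
  · exact ⟨cert5, by decide +kernel⟩
  · exact ⟨cert6, by decide +kernel⟩
  · exact ⟨cert7, by decide +kernel⟩
  · exact ⟨cert8, by decide +kernel⟩

theorem reduce4 {p} (hp : p ∈ goodPats) {u : List ℕ} (hu : u.Nodup) (h4 : u.length = 4) :
    ∃ v, v.length = 3 ∧ LEq p u v := by
  obtain ⟨cs, hcs⟩ := cert_exists hp
  have hP : std u ∈ (List.range' 1 4).permutations' := by
    rw [List.mem_permutations']
    have := std_perm hu
    unfold IsPermList at this
    rwa [← (std_iso u).1, h4] at this
  simp only [checkAll, Bool.and_eq_true, List.all_eq_true, List.any_eq_true, beq_iff_eq] at hcs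
  obtain ⟨c, -, h1, h2⟩ := hcs.1 _ hP
  exact ⟨_, h2, (LEq.iso hu (std_iso u)).trans (chainOK_spec hp h1)⟩

theorem base3 {p} (hp : p ∈ goodPats) {u : List ℕ} (hu : IsPermList u) (h3 : u.length = 3)
    (hne : u ≠ [1, 2, 3]) : LEq p u [3, 2, 1] := by
  obtain ⟨cs, hcs⟩ := cert_exists hp
  have hP : u ∈ (List.range' 1 3).permutations' := by
    rw [List.mem_permutations']
    unfold IsPermList at hu
    rwa [h3] at hu
  simp only [checkAll, Bool.and_eq_true, Bool.or_eq_true, List.all_eq_true, List.any_eq_true,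
    beq_iff_eq] at hcs
  rcases hcs.2 _ hP with h | ⟨c, -, h1, h2⟩
  · exact absurd h hne
  · rw [← h2]
    exact chainOK_spec hp h1

theorem reduce {p} (hp : p ∈ goodPats) (n : ℕ) : ∀ u : List ℕ, u.Nodup → u.length = n + 3 →
    ∃ v, v.length = 3 ∧ LEq p u v := by
  induction n with
  | zero => exact fun u hu h => ⟨u, h, LEq.iso hu (OrdIso.rfl' _)⟩
  | succ n ih =>
    intro u hu h
    have ht : (u.take 4).length = 4 := by rw [List.length_take]; omega
    have hn : (u.take 4 ++ u.drop 4).Nodup := by rwa [List.take_append_drop]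
    obtain ⟨v, hv, hE⟩ := reduce4 hp (hu.sublist (List.take_sublist 4 u)) ht
    obtain ⟨v0, w, h1, h2, h3, h4⟩ := hE.lift hp _ _ (OrdIso.rfl' _) hn
    rw [List.take_append_drop] at h4
    obtain ⟨v1, g1, g2⟩ := ih (v0 ++ w) h2 (by
      rw [List.length_append, h3, ← h1.1, hv, List.length_drop]; omega)
    exact ⟨v1, g1, h4.trans g2⟩

/-! ### Small classes -/

theorem Repl.full {a b ρ₁ ρ₂ : SPat} (h : Repl a b ρ₁ ρ₂)
    (he : (ints ρ₁).length ≤ (ints a).length) : ints ρ₁ = ints a ∧ ints ρ₂ = ints b := by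
  induction h with
  | nil => exact ⟨rfl, rfl⟩
  | keep x hR ih =>
    have hs := (hR.sub1.filterMap id).length_le
    change (ints _).length ≤ (ints _).length at hs
    rw [ints_cons, List.length_append] at he
    cases x with
    | none => simpa [ints_cons] using ih (by omega)
    | some k => simp only [Option.toList, List.length_cons, List.length_nil] at he; omega
  | repl x y hR ih =>
    simp only [ints_cons, List.length_append] at he ⊢
    obtain ⟨h1, h2⟩ := ih (by omega)
    rw [h1, h2]
    exact ⟨rfl, rfl⟩

theorem OrdIso.sorted {u v : List ℕ} (h : OrdIso u v) (hu : u.Pairwise (· < ·)) :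
    v.Pairwise (· < ·) := by
  rw [List.pairwise_iff_getElem] at hu ⊢
  intro i j hi hj hij
  have hi' : i < u.length := by rw [h.1]; exact hi
  have hj' : j < u.length := by rw [h.1]; exact hj
  have := (h.2 i j hi' hj').1
  simp only [List.getD, List.getElem?_eq_getElem hi, List.getElem?_eq_getElem hj,
    List.getElem?_eq_getElem hi', List.getElem?_eq_getElem hj', Option.getD_some] at this
  exact this (hu i j hi' hj' hij)

theorem IsResult.inv {α β : SPat} {π σ : List ℕ} (h : IsResult α β π σ) :
    IsPermList σ ∧ (ints α).length ≤ π.length ∧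
    (π.Pairwise (· < ·) → (ints α).Pairwise (· < ·)) ∧
    (π.length ≤ (ints α).length → OrdIso σ (ints β)) := by
  obtain ⟨ρ₁, ρ₂, a, b, -, h1, ha, -, hb, -, -, hR, hσ, h2⟩ := h
  have hs : (ints a).Sublist (ints ρ₁) := hR.sub1.filterMap id
  have hl := ha.2.2.1
  refine ⟨hσ, ?_, ?_, ?_⟩
  · rw [← hl, h1.1]; exact hs.length_le
  · intro hp
    exact ha.2.2.sorted ((h1.sorted hp).sublist hs)
  · intro hle
    have := (hR.full (by rw [← h1.1, hl]; exact hle)).2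
    rw [this] at h2
    exact h2.symm'.trans' hb.2.2

theorem ints_pat {p} (hp : p ∈ goodPats) : OrdIso (ints (toPat p)) [2, 1] := by
  simp only [goodPats, List.mem_cons, List.not_mem_nil, or_false] at hp
  rcases hp with rfl | rfl | rfl | rfl | rfl | rfl | rfl | rfl | rfl <;>
    exact ordIso2 (by omega) (by omega)

theorem perm21 : IsPermList [2, 1] := by unfold IsPermList; decide

theorem perm123 : IsPermList [1, 2, 3] := by unfold IsPermList; decide

theorem step_sorted {p} (hp : p ∈ goodPats) {π σ : List ℕ} (hs : π.Pairwise (· < ·))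
    (h : IsResult pat123 (toPat p) π σ ∨ IsResult (toPat p) pat123 π σ) :
    3 ≤ π.length ∧ (π.length = 3 → σ = [2, 1]) := by
  rcases h with h | h
  · obtain ⟨h1, h2, -, h3⟩ := h.inv
    refine ⟨h2, fun h => perm_eq_of_iso h1 perm21 ((h3 (by rw [h]; rfl)).trans' (ints_pat hp))⟩
  · have := (ints_pat hp).sorted (h.inv.2.2.1 hs)
    simp at this

theorem step_21 {p} (hp : p ∈ goodPats) {σ : List ℕ}
    (h : IsResult pat123 (toPat p) [2, 1] σ ∨ IsResult (toPat p) pat123 [2, 1] σ) :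
    σ = [1, 2, 3] := by
  rcases h with h | h
  · have := h.inv.2.1
    simp [pat123, ints] at this
  · obtain ⟨h1, -, -, h3⟩ := h.inv
    exact perm_eq_of_iso h1 perm123 (h3 (by rw [(ints_pat hp).1]))

theorem iso_small {p} (hp : p ∈ goodPats) {π : List ℕ} (hs : π.Pairwise (· < ·))
    (hl : π.length < 3) (σ : List ℕ) : PermEquiv pat123 (toPat p) π σ ↔ σ = π := by
  constructor
  · intro h
    induction h with
    | refl => rfl
    | tail _ h2 ih =>
      subst ih
      have := (step_sorted hp hs h2).1
      omega
  · rintro rfl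
    exact Relation.ReflTransGen.refl

theorem class_123 {p} (hp : p ∈ goodPats) {π σ : List ℕ} (hπ : π = [1, 2, 3] ∨ π = [2, 1])
    (h : PermEquiv pat123 (toPat p) π σ) : σ = [1, 2, 3] ∨ σ = [2, 1] := by
  induction h with
  | refl => exact hπ
  | tail _ h2 ih =>
    rcases ih with rfl | rfl
    · exact Or.inr ((step_sorted hp (by simp) h2).2 rfl)
    · exact Or.inl (step_21 hp h2)

theorem equiv_123_21 {p} (hp : p ∈ goodPats) :
    PermEquiv pat123 (toPat p) [1, 2, 3] [2, 1] := by
  have h : Fwd p [1, 2, 3] (outp p 1 2 3 [] [] [] []) :=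
    ⟨by decide, 1, 2, 3, [], [], [], [], by omega, by omega, rfl, rfl⟩
  refine (LEq.fwd h).sound hp _ _ perm123 perm21 (OrdIso.rfl' _) ?_
  simp only [goodPats, List.mem_cons, List.not_mem_nil, or_false] at hp
  rcases hp with rfl | rfl | rfl | rfl | rfl | rfl | rfl | rfl | rfl <;>
    exact ordIso2 (by omega) (by omega)

theorem to_321 {p} (hp : p ∈ goodPats) {π : List ℕ} (hπ : IsPermList π)
    (hn : π ∉ ([[], [1], [1, 2], [1, 2, 3], [2, 1]] : List (List ℕ))) : LEq p π [3, 2, 1] := by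
  simp only [List.mem_cons, List.not_mem_nil, or_false, not_or] at hn
  have h3 : 3 ≤ π.length := by
    by_contra hc
    have hP : π ∈ (List.range' 1 π.length).permutations' := List.mem_permutations'.2 hπ
    have : π.length = 0 ∨ π.length = 1 ∨ π.length = 2 := by omega
    rcases this with e | e | e <;> rw [e] at hP <;>
      simp [List.range', List.permutations', List.permutations'Aux] at hP <;> tauto
  obtain ⟨v, hv, hE⟩ := reduce hp (π.length - 3) π hπ.nodup' (by omega)
  have hnv := (hE.nodup hp).2
  have hE2 : LEq p π (std v) := hE.trans (LEq.iso hnv (std_iso v))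
  have hsp := std_perm hnv
  refine hE2.trans (base3 hp hsp (by rw [← (std_iso v).1, hv]) ?_)
  intro he
  have := class_123 hp (Or.inl he) (hE2.symm.sound hp _ _ hsp hπ (OrdIso.rfl' _) (OrdIso.rfl' _))
  tauto

theorem main_classes {p} (hp : p ∈ goodPats) :
    (∀ σ : List ℕ, IsPermList σ → (PermEquiv pat123 (toPat p) [] σ ↔ σ = [])) ∧
    (∀ σ : List ℕ, IsPermList σ → (PermEquiv pat123 (toPat p) [1] σ ↔ σ = [1])) ∧
    (∀ σ : List ℕ, IsPermList σ → (PermEquiv pat123 (toPat p) [1, 2] σ ↔ σ = [1, 2])) ∧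
    (∀ σ : List ℕ, IsPermList σ →
      (PermEquiv pat123 (toPat p) [1, 2, 3] σ ↔ (σ = [1, 2, 3] ∨ σ = [2, 1]))) ∧
    (∀ π σ : List ℕ, IsPermList π → IsPermList σ →
      π ∉ ([[], [1], [1, 2], [1, 2, 3], [2, 1]] : List (List ℕ)) →
      σ ∉ ([[], [1], [1, 2], [1, 2, 3], [2, 1]] : List (List ℕ)) →
      PermEquiv pat123 (toPat p) π σ) := by
  refine ⟨fun σ _ => iso_small hp (by simp) (by simp) σ,
    fun σ _ => iso_small hp (by simp) (by simp) σ,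
    fun σ _ => iso_small hp (by simp) (by simp) σ, fun σ _ => ⟨class_123 hp (Or.inl rfl), ?_⟩, ?_⟩
  · rintro (rfl | rfl)
    · exact Relation.ReflTransGen.refl
    · exact equiv_123_21 hp
  · intro π σ hπ hσ h1 h2
    exact ((to_321 hp hπ h1).trans (to_321 hp hσ h2).symm).sound hp _ _ hπ hσ
      (OrdIso.rfl' _) (OrdIso.rfl' _)

/-- for each of the nine decreasing `β`, there are exactly five
equivalence classes under `123 ↔ β`: `{∅}`, `{1}`, `{12}`, `{123, 21}`, and one
class containing all other permutations. -/
theorem decreasing_classes :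
    ∀ β ∈ ([patS32, pat3S2, pat32S, patS31, pat3S1, pat31S,
            patS21, pat2S1, pat21S] : List SPat),
    (∀ σ : List ℕ, IsPermList σ → (PermEquiv pat123 β [] σ ↔ σ = [])) ∧
    (∀ σ : List ℕ, IsPermList σ → (PermEquiv pat123 β [1] σ ↔ σ = [1])) ∧
    (∀ σ : List ℕ, IsPermList σ → (PermEquiv pat123 β [1, 2] σ ↔ σ = [1, 2])) ∧
    (∀ σ : List ℕ, IsPermList σ →
      (PermEquiv pat123 β [1, 2, 3] σ ↔ (σ = [1, 2, 3] ∨ σ = [2, 1]))) ∧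
    (∀ π σ : List ℕ, IsPermList π → IsPermList σ →
      π ∉ ([[], [1], [1, 2], [1, 2, 3], [2, 1]] : List (List ℕ)) →
      σ ∉ ([[], [1], [1, 2], [1, 2, 3], [2, 1]] : List (List ℕ)) →
      PermEquiv pat123 β π σ) := by
  intro β hβ
  obtain ⟨p, hp, rfl⟩ : ∃ p, p ∈ goodPats ∧ toPat p = β := by
    simp only [List.mem_cons, List.not_mem_nil, or_false] at hβ
    rcases hβ with rfl | rfl | rfl | rfl | rfl | rfl | rfl | rfl | rfl <;>
      exact ⟨(_, _, _), by unfold goodPats; decide, rfl⟩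
  exact main_classes hp
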